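/- Let A be a (not necessarily commutative) ring. The following conditions are equivalent: (1) the Laurent series ring A((x)) is a right serial ring; (2) A((x)) is a right serial right Artinian ring; (3) A is a right serial right Artinian ring. -/

import Mathlib

/-- A module is *uniserial* if any two of its submodules are comparable with
respect to inclusion. -/
def IsUniserialModule (R M : Type*) [Ring R] [AddCommGroup M] [Module R M] : Prop :=
  ∀ N₁ N₂ : Submodule R M, N₁ ≤ N₂ ∨ N₂ ≤ N₁

/-- A ring `A` is *right serial* if `A` is a finite direct sum of uniserial right
ideals, i.e. the right module `A_A` is a serial module.  Right ideals of `A` are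
the submodules of `A` viewed as a right module over itself, i.e. as a module
over the opposite ring `Aᵐᵒᵖ`. -/
def IsRightSerialRing (A : Type*) [Ring A] : Prop :=
  ∃ (ι : Type) (_ : Fintype ι) (N : ι → Submodule Aᵐᵒᵖ A),
    iSupIndep N ∧ (⨆ i, N i) = ⊤ ∧ ∀ i, IsUniserialModule Aᵐᵒᵖ (N i)

/-- A ring `A` is *left serial* if `A` is a finite direct sum of uniserial left
ideals, i.e. the left module `_AA` is a serial module. -/
def IsLeftSerialRing (A : Type*) [Ring A] : Prop :=
  ∃ (ι : Type) (_ : Fintype ι) (N : ι → Submodule A A),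
    iSupIndep N ∧ (⨆ i, N i) = ⊤ ∧ ∀ i, IsUniserialModule A (N i)

/-- A module `M` is *finite-dimensional* if it contains no infinite direct sum of
nonzero submodules, i.e. there is no infinite independent family of nonzero
submodules of `M`. -/
def IsFinDimModule (R M : Type*) [Ring R] [AddCommGroup M] [Module R M] : Prop :=
  ¬ ∃ (ι : Type) (_ : Infinite ι) (N : ι → Submodule R M),
      (∀ i, N i ≠ ⊥) ∧ iSupIndep N

/-- A module `M` is *quotient finite-dimensional* if every factor module of `M`
is finite-dimensional. -/
def IsQFDModule (R M : Type*) [Ring R] [AddCommGroup M] [Module R M] : Prop :=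
  ∀ N : Submodule R M, IsFinDimModule R (M ⧸ N)

open Finset in
/-- Among more than `#s` elements of a sum of `#s` uniserial submodules, one is redundant. -/
theorem exists_mem_span_of_uniserial {R M ι κ : Type*} [Ring R] [AddCommGroup M] [Module R M]
    [DecidableEq ι] [DecidableEq κ] (N : ι → Submodule R M)
    (hN : ∀ i, IsUniserialModule R (N i)) (s : Finset ι) :
    ∀ (t : Finset κ) (v : κ → M), #s < #t → (∀ j ∈ t, v j ∈ ⨆ i ∈ s, N i) →
      ∃ j ∈ t, v j ∈ Submodule.span R (v '' (t.erase j)) := by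
  induction s using Finset.induction_on with
  | empty =>
    intro t v ht hv
    obtain ⟨j, hj⟩ := Finset.card_pos.1 (by simpa using ht)
    refine ⟨j, hj, ?_⟩
    have : v j = 0 := by simpa using hv j hj
    simp [this]
  | insert a s ha ih =>
    intro t v ht hv
    have key : ∀ j, ∃ u w, j ∈ t → u ∈ N a ∧ w ∈ (⨆ i ∈ s, N i) ∧ u + w = v j := by
      intro j
      by_cases hj : j ∈ t
      · have := hv j hj
        rw [Finset.iSup_insert, Submodule.mem_sup] at this
        obtain ⟨u, hu, w, hw, h⟩ := this
        exact ⟨u, w, fun _ => ⟨hu, hw, h⟩⟩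
      · exact ⟨0, 0, fun h => absurd h hj⟩
    choose u w huw using key
    have hcmp : ∀ x ∈ N a, ∀ y ∈ N a, (∃ r : R, x = r • y) ∨ ∃ r : R, y = r • x := by
      intro x hx y hy
      rcases hN a (Submodule.span R {⟨x, hx⟩}) (Submodule.span R {⟨y, hy⟩}) with h | h
      · left
        obtain ⟨r, hr⟩ := Submodule.mem_span_singleton.1 (h (Submodule.mem_span_singleton_self _))
        exact ⟨r, by simpa using (congrArg Subtype.val hr).symm⟩
      · right
        obtain ⟨r, hr⟩ := Submodule.mem_span_singleton.1 (h (Submodule.mem_span_singleton_self _))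
        exact ⟨r, by simpa using (congrArg Subtype.val hr).symm⟩
    have hmax : ∀ t' : Finset κ, t'.Nonempty → t' ⊆ t →
        ∃ j₀ ∈ t', ∀ j ∈ t', ∃ r : R, u j = r • u j₀ := by
      intro t' hne
      induction hne using Finset.Nonempty.cons_induction with
      | singleton b => exact fun _ => ⟨b, by simp, fun j hj => ⟨1, by simp_all⟩⟩
      | cons b t' hb hne ih' =>
        intro hsub
        rw [Finset.cons_subset] at hsub
        obtain ⟨j₀, hj₀, h⟩ := ih' hsub.2
        rcases hcmp _ (huw b hsub.1).1 _ (huw j₀ (hsub.2 hj₀)).1 with ⟨r, hr⟩ | ⟨r, hr⟩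
        · refine ⟨j₀, by simp [hj₀], fun j hj => ?_⟩
          rcases Finset.mem_cons.1 hj with rfl | hj
          · exact ⟨r, hr⟩
          · exact h j hj
        · refine ⟨b, by simp, fun j hj => ?_⟩
          rcases Finset.mem_cons.1 hj with rfl | hj
          · exact ⟨1, by simp⟩
          · obtain ⟨r', hr'⟩ := h j hj
            exact ⟨r' * r, by rw [hr', hr, mul_smul]⟩
    obtain ⟨j₀, hj₀, hr⟩ := hmax t (Finset.card_pos.1 (by omega)) subset_rfl
    have hr' : ∀ j, ∃ r : R, j ∈ t → u j = r • u j₀ := fun j => by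
      by_cases hj : j ∈ t
      · obtain ⟨r, h⟩ := hr j hj
        exact ⟨r, fun _ => h⟩
      · exact ⟨0, fun h => absurd h hj⟩
    choose r hr using hr'
    obtain ⟨j, hj, hmem⟩ := ih (t.erase j₀) (fun j => v j - r j • v j₀)
      (by rw [Finset.card_erase_of_mem hj₀]; rw [Finset.card_insert_of_notMem ha] at ht; omega)
      (by
        intro j hj
        have hjt := Finset.mem_of_mem_erase hj
        have : v j - r j • v j₀ = w j - r j • w j₀ := by
          rw [← (huw j hjt).2.2, ← (huw j₀ hj₀).2.2, hr j hjt, smul_add]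
          abel
        rw [this]
        exact sub_mem (huw j hjt).2.1 (Submodule.smul_mem _ _ (huw j₀ hj₀).2.1))
    have hjt := Finset.mem_of_mem_erase hj
    have hne := Finset.ne_of_mem_erase hj
    refine ⟨j, hjt, ?_⟩
    have hj₀mem : v j₀ ∈ Submodule.span R (v '' (t.erase j)) :=
      Submodule.subset_span ⟨j₀, by simp [hj₀, hne.symm], rfl⟩
    have hle : Submodule.span R ((fun j => v j - r j • v j₀) '' ((t.erase j₀).erase j)) ≤
        Submodule.span R (v '' (t.erase j)) := by
      rw [Submodule.span_le]
      rintro _ ⟨l, hl, rfl⟩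
      simp only [Finset.coe_erase, Set.mem_sdiff, Finset.mem_coe, Set.mem_singleton_iff] at hl
      refine sub_mem (Submodule.subset_span ⟨l, by simp [hl], rfl⟩) (Submodule.smul_mem _ _ hj₀mem)
    have := add_mem (hle hmem) (Submodule.smul_mem _ (r j) hj₀mem)
    simpa using this

/-- A module has *bounded generators* if, for some `n`, any `n + 1` elements
contain a redundant one. -/
def HasBoundedGenerators (R M : Type*) [Ring R] [AddCommGroup M] [Module R M] : Prop :=
  ∃ n : ℕ, ∀ v : ℕ → M, ∃ i ∈ Finset.range (n + 1),
    v i ∈ Submodule.span R (v '' ((Finset.range (n + 1)).erase i))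

theorem hasBoundedGenerators_of_uniserial {R M ι : Type*} [Ring R] [AddCommGroup M] [Module R M]
    [Fintype ι] (N : ι → Submodule R M) (hN : ∀ i, IsUniserialModule R (N i))
    (htop : ⨆ i, N i = ⊤) : HasBoundedGenerators R M := by
  classical
  refine ⟨Fintype.card ι, fun v => ?_⟩
  exact exists_mem_span_of_uniserial N hN Finset.univ (Finset.range (Fintype.card ι + 1)) v
    (by simp) (by simp [htop])

section LeftPiRegular

variable {A : Type*} [Ring A]

theorem exists_pow_eq_mul_pow_mul_pow {a b : A} {k : ℕ} (h : a ^ k = b * a ^ (k + 1)) :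
    ∃ c, a ^ k = c * (a ^ k * a ^ k) := by
  have key : ∀ n, a ^ k = b ^ n * a ^ (k + n) := by
    intro n
    induction n with
    | zero => simp
    | succ n ih =>
      calc a ^ k = b ^ n * (a ^ k * a ^ n) := by rw [← pow_add, ← ih]
        _ = b ^ n * (b * a ^ (k + 1) * a ^ n) := by rw [← h]
        _ = b ^ (n + 1) * a ^ (k + (n + 1)) := by
          rw [pow_succ b, show k + (n + 1) = k + 1 + n by ring, pow_add a (k + 1) n]
          simp only [mul_assoc]
  exact ⟨b ^ k, by rw [← pow_add]; exact key k⟩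

/-- In a left noetherian ring, a nonzero element `y` with `y = c * y ^ 2` gives a nonzero
idempotent in `A * y`. -/
theorem exists_idempotent_of_eq_mul [IsNoetherianRing A] {y c : A} (h : y = c * (y * y)) :
    (c * y) * (c * y) = c * y ∧ (c * y) * y = y := by
  have hy : (c * y) * y = y := by rw [mul_assoc, ← h]
  refine ⟨?_, hy⟩
  let N : Submodule A A := Submodule.span A {y}
  have hyN : y ∈ N := Submodule.mem_span_singleton_self y
  let ρ : N →ₗ[A] N :=
    { toFun := fun n => ⟨n * y, N.smul_mem _ hyN⟩
      map_add' := fun a b => Subtype.ext (add_mul _ _ _)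
      map_smul' := fun r a => Subtype.ext (mul_assoc _ _ _) }
  have hsurj : Function.Surjective ρ := by
    rintro ⟨n, hn⟩
    obtain ⟨r, rfl⟩ := Submodule.mem_span_singleton.1 hn
    refine ⟨⟨r * c * y, N.smul_mem _ hyN⟩, Subtype.ext ?_⟩
    change r * c * y * y = r * y
    rw [mul_assoc r, mul_assoc r, hy]
  have hinj := IsNoetherian.injective_of_surjective_endomorphism ρ hsurj
  have := @hinj ⟨c * y * (c * y), N.smul_mem _ (N.smul_mem _ hyN)⟩ ⟨c * y, N.smul_mem _ hyN⟩
    (Subtype.ext (by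
      change c * y * (c * y) * y = c * y * y
      rw [mul_assoc (c * y), hy, hy]))
  exact congrArg Subtype.val this

/-- A left noetherian left π-regular ring without nonzero nil left ideals is semisimple. -/
theorem isSemisimpleRing_of_pow_eq [IsNoetherianRing A]
    (hπ : ∀ a : A, ∃ (k : ℕ) (b : A), a ^ k = b * a ^ (k + 1))
    (hnil : ∀ L : Ideal A, (∀ a ∈ L, IsNilpotent a) → L = ⊥) : IsSemisimpleRing A := by
  have hidem : ∀ L : Ideal A, L ≠ ⊥ → ∃ e ∈ L, e * e = e ∧ e ≠ 0 := by
    intro L hL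
    obtain ⟨a, ha, hna⟩ : ∃ a ∈ L, ¬ IsNilpotent a := by
      by_contra! h
      exact hL (hnil L h)
    obtain ⟨k, b, hk⟩ := hπ a
    obtain ⟨c, hc⟩ := exists_pow_eq_mul_pow_mul_pow hk
    obtain ⟨h1, h2⟩ := exists_idempotent_of_eq_mul hc
    rcases k with _ | k
    · refine ⟨1, ?_, by simp, fun h => hna ⟨1, by rw [pow_one, ← mul_one a, h, mul_zero]⟩⟩
      have h0 : (1 : A) = b * a := by simpa using hk
      rw [h0]
      exact L.mul_mem_left _ ha
    · refine ⟨c * a ^ (k + 1), L.mul_mem_left _ ?_, h1, fun h => hna ⟨k + 1, ?_⟩⟩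
      · rw [pow_succ]
        exact L.mul_mem_left _ ha
      · rw [← h2, h, zero_mul]
  have hcompl : ∀ L : Ideal A, ∃ e ∈ L, e * e = e ∧ ∀ x ∈ L, x * e = x := by
    intro L
    let S : Set (Ideal A) := {I | ∃ e ∈ L, e * e = e ∧ I = Ideal.span {e}}
    obtain ⟨_, ⟨e, heL, hee, rfl⟩, hmax⟩ := WellFounded.has_min
      (wellFounded_gt : WellFounded ((· > ·) : Ideal A → Ideal A → Prop)) S
      ⟨_, 0, L.zero_mem, by simp, rfl⟩
    refine ⟨e, heL, hee, fun x hx => ?_⟩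
    let L' : Ideal A :=
      { carrier := {x | x ∈ L ∧ x * e = 0}
        add_mem' := fun ha hb => ⟨add_mem ha.1 hb.1, by rw [add_mul, ha.2, hb.2, add_zero]⟩
        zero_mem' := ⟨L.zero_mem, zero_mul _⟩
        smul_mem' := fun r x hx => ⟨L.mul_mem_left _ hx.1, by
          rw [smul_eq_mul, mul_assoc, hx.2, mul_zero]⟩ }
    have hL' : L' = ⊥ := by
      by_contra hne
      obtain ⟨f, ⟨hfL, hfe⟩, hff, hf0⟩ := hidem L' hne
      have h1 : e * (e + f - e * f) = e := by
        rw [mul_sub, mul_add, ← mul_assoc, hee]; abel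
      have h2 : f * (e + f - e * f) = f := by
        rw [mul_sub, mul_add, ← mul_assoc, hfe, hff]; simp
      refine hmax (Ideal.span {e + f - e * f}) ⟨_, ?_, ?_, rfl⟩ (lt_of_le_not_ge ?_ fun hle => ?_)
      · exact sub_mem (add_mem heL hfL) (L.mul_mem_left _ hfL)
      · rw [sub_mul, add_mul, mul_assoc, h1, h2]
      · rw [Ideal.span_singleton_le_iff_mem]
        exact Ideal.mem_span_singleton'.2 ⟨e, h1⟩
      · have : f ∈ Ideal.span {e} := hle (Ideal.mem_span_singleton'.2 ⟨f, h2⟩)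
        obtain ⟨r, hr⟩ := Ideal.mem_span_singleton'.1 this
        apply hf0
        rw [← hr, ← hee, ← mul_assoc, hr, hfe]
    have : x - x * e ∈ L' := ⟨sub_mem hx (L.mul_mem_left _ heL), by
      rw [sub_mul, mul_assoc, hee, sub_self]⟩
    rw [hL', Submodule.mem_bot, sub_eq_zero] at this
    exact this.symm
  refine { exists_isCompl := fun L => ?_ }
  obtain ⟨e, heL, -, he⟩ := hcompl L
  refine ⟨Ideal.span {1 - e}, ?_, ?_⟩
  · rw [Submodule.disjoint_def]
    intro x hxL hx
    obtain ⟨r, rfl⟩ := Ideal.mem_span_singleton'.1 hx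
    rw [← he _ hxL, mul_assoc, sub_mul, one_mul, he e heL, sub_self, mul_zero]
  · rw [codisjoint_iff, Ideal.eq_top_iff_one, Submodule.mem_sup]
    exact ⟨e, heL, 1 - e, Ideal.mem_span_singleton_self _, by abel⟩

/-- Levitzki's theorem: nil two-sided ideals of left noetherian rings are nilpotent. -/
theorem isNilpotent_of_nil [IsNoetherianRing A] (J : Ideal A) [J.IsTwoSided]
    (hJ : ∀ a ∈ J, IsNilpotent a) : IsNilpotent J := by
  obtain ⟨N, ⟨hN2, hN⟩, hmax⟩ := WellFounded.has_min
    (wellFounded_gt : WellFounded ((· > ·) : Ideal A → Ideal A → Prop))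
    {I | I.IsTwoSided ∧ IsNilpotent I} ⟨⊥, inferInstance, 1, by simp⟩
  suffices h : J ≤ N by
    obtain ⟨k, hk⟩ := hN
    exact ⟨k, le_bot_iff.1 ((Ideal.pow_right_mono h k).trans hk.le)⟩
  by_contra hJN
  obtain ⟨a₀, ha₀J, ha₀N⟩ := SetLike.not_le_iff_exists.1 hJN
  let l : A → Ideal A := fun a =>
    { carrier := {y | y * a ∈ N}
      add_mem' := fun {x y} hx hy => by
        change (x + y) * a ∈ N
        rw [add_mul]; exact add_mem hx hy
      zero_mem' := by simp
      smul_mem' := fun r x hx => by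
        change r * x * a ∈ N
        rw [mul_assoc]; exact N.mul_mem_left _ hx }
  obtain ⟨_, ⟨a, ⟨haJ, haN⟩, rfl⟩, hamax⟩ := WellFounded.has_min
    (wellFounded_gt : WellFounded ((· > ·) : Ideal A → Ideal A → Prop))
    (l '' {a | a ∈ J ∧ a ∉ N}) ⟨_, a₀, ⟨ha₀J, ha₀N⟩, rfl⟩
  have haza : ∀ z, a * z * a ∈ N := by
    intro z
    have hnil : ∃ k, (a * z) ^ k ∈ N := by
      obtain ⟨k, hk⟩ := hJ (a * z) (J.mul_mem_right _ haJ)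
      exact ⟨k, hk ▸ N.zero_mem⟩
    obtain ⟨k, hk, hlt⟩ : ∃ k, (a * z) ^ k ∈ N ∧ ∀ m < k, (a * z) ^ m ∉ N := by
      classical
      exact ⟨Nat.find hnil, Nat.find_spec hnil, fun m hm => Nat.find_min hnil hm⟩
    match k with
    | 0 =>
      rw [pow_zero] at hk
      exact absurd (by simpa using N.mul_mem_left a hk) haN
    | 1 =>
      rw [pow_one] at hk
      exact N.mul_mem_right _ hk
    | m + 2 =>
      have hb : (a * z) ^ (m + 1) ∉ N := hlt _ (by omega)
      have hbJ : (a * z) ^ (m + 1) ∈ J := by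
        rw [pow_succ]
        exact J.mul_mem_left _ (J.mul_mem_right _ haJ)
      have hle : l a ≤ l ((a * z) ^ (m + 1)) := by
        intro y hy
        change y * (a * z) ^ (m + 1) ∈ N
        rw [pow_succ', ← mul_assoc, ← mul_assoc]
        exact N.mul_mem_right _ (N.mul_mem_right _ hy)
      have heq : l ((a * z) ^ (m + 1)) ≤ l a := by
        by_contra hcon
        exact hamax _ ⟨_, ⟨hbJ, hb⟩, rfl⟩ (lt_of_le_not_ge hle hcon)
      refine heq (?_ : a * z * (a * z) ^ (m + 1) ∈ N)
      rw [← pow_succ']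
      exact hk
  let D : Ideal A :=
    { carrier := {y | (∀ r, a * r * y ∈ N) ∧ ∀ e, (∀ r, a * r * e ∈ N) → y * e ∈ N}
      add_mem' := fun hx hy => ⟨fun r => by rw [mul_add]; exact add_mem (hx.1 r) (hy.1 r),
        fun e he => by rw [add_mul]; exact add_mem (hx.2 e he) (hy.2 e he)⟩
      zero_mem' := ⟨by simp, by simp⟩
      smul_mem' := fun c x hx => ⟨fun r => by
          rw [smul_eq_mul, ← mul_assoc, mul_assoc a r c]; exact hx.1 _,
        fun e he => by rw [smul_eq_mul, mul_assoc]; exact N.mul_mem_left _ (hx.2 e he)⟩ }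
  have hD2 : D.IsTwoSided := ⟨fun {x} c hx => ⟨fun r => by
    rw [← mul_assoc]; exact N.mul_mem_right _ (hx.1 r), fun e he => by
    rw [mul_assoc]
    refine hx.2 _ fun r => ?_
    rw [← mul_assoc, mul_assoc a r c]
    exact he _⟩⟩
  have haD : a ∈ D := ⟨haza, fun e he => by simpa using he 1⟩
  have hsup : (N ⊔ D).IsTwoSided := ⟨fun {x} c hx => by
    obtain ⟨n, hn, d, hd, rfl⟩ := Submodule.mem_sup.1 hx
    rw [add_mul]
    exact add_mem (Ideal.mem_sup_left (N.mul_mem_right _ hn))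
      (Ideal.mem_sup_right (D.mul_mem_right _ hd))⟩
  refine hmax (N ⊔ D) ⟨hsup, ?_⟩ (lt_of_le_not_ge le_sup_left fun h =>
    haN (h (Ideal.mem_sup_right haD)))
  have hsq : (N ⊔ D) * (N ⊔ D) ≤ N := by
    rw [Ideal.mul_le]
    intro x hx y hy
    obtain ⟨n, hn, d, hd, rfl⟩ := Submodule.mem_sup.1 hx
    obtain ⟨n', hn', d', hd', rfl⟩ := Submodule.mem_sup.1 hy
    rw [add_mul, mul_add d]
    exact add_mem (N.mul_mem_right _ hn) (add_mem (N.mul_mem_left _ hn') (hd.2 _ hd'.1))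
  obtain ⟨k, hk⟩ := hN
  have hpow : ∀ j, (N ⊔ D) ^ (j * 2) ≤ N ^ j := by
    intro j
    induction j with
    | zero => rw [zero_mul, Submodule.pow_zero, Submodule.pow_zero]
    | succ j ih =>
      rw [add_mul, Ideal.IsTwoSided.pow_add, Ideal.IsTwoSided.pow_add (I := N)]
      refine Ideal.mul_mono ih ?_
      rw [one_mul, Submodule.pow_one, show 2 = 1 + 1 from rfl, Ideal.IsTwoSided.pow_add,
        Submodule.pow_one]
      exact hsq
  exact ⟨k * 2, le_bot_iff.1 ((hpow k).trans hk.le)⟩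

theorem isArtinianRing_of_pow_eq [IsNoetherianRing A]
    (hπ : ∀ a : A, ∃ (k : ℕ) (b : A), a ^ k = b * a ^ (k + 1)) : IsArtinianRing A := by
  have hss : IsSemisimpleRing (A ⧸ Ring.jacobson A) := by
    have : IsNoetherianRing (A ⧸ Ring.jacobson A) :=
      isNoetherianRing_of_surjective _ _ (Ideal.Quotient.mk (Ring.jacobson A))
        Ideal.Quotient.mk_surjective
    refine isSemisimpleRing_of_pow_eq (fun a => ?_) fun L hL => ?_
    · obtain ⟨a, rfl⟩ := Ideal.Quotient.mk_surjective a
      obtain ⟨k, b, h⟩ := hπ a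
      exact ⟨k, Ideal.Quotient.mk _ b, by rw [← map_pow, h, map_mul, map_pow]⟩
    · rw [← le_bot_iff, ← Ring.jacobson_quotient_jacobson A]
      intro x hx
      rw [← Ideal.jacobson_bot (R := A ⧸ Ring.jacobson A), Ideal.mem_jacobson_iff]
      intro y
      obtain ⟨u, hu⟩ := (hL _ (L.mul_mem_left y hx)).isUnit_add_one
      refine ⟨↑u⁻¹, ?_⟩
      have : ↑u⁻¹ * (y * x + 1) = 1 := by rw [← hu, Units.inv_mul]
      rw [Ideal.mem_bot, mul_assoc, ← mul_add_one, this, sub_self]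
  have hnil : IsNilpotent (Ring.jacobson A) := by
    refine isNilpotent_of_nil _ fun a ha => ?_
    obtain ⟨k, b, h⟩ := hπ a
    rw [← Ideal.jacobson_bot, Ideal.mem_jacobson_iff] at ha
    obtain ⟨z, hz⟩ := ha (-b)
    have hz : z * (1 - b * a) = 1 := by
      rw [Ideal.mem_bot, sub_eq_zero] at hz
      rw [mul_sub, mul_one, ← mul_assoc, sub_eq_neg_add, ← neg_mul, ← mul_neg, hz]
    refine ⟨k, ?_⟩
    rw [← one_mul (a ^ k), ← hz, mul_assoc, sub_mul, one_mul, mul_assoc, ← pow_succ', ← h, sub_self,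
      mul_zero]
  have : IsSemiprimaryRing A := ⟨hss, hnil⟩
  exact (IsSemiprimaryRing.isNoetherian_iff_isArtinian (R := A) (M := A)).1 ‹_›

end LeftPiRegular
section LaurentSeries

variable {A : Type*} [Ring A]

theorem LaurentSeries.coeff_mul_mem (I : Ideal A) {f g : LaurentSeries A} {m : ℤ}
    (h : ∀ i j, i + j = m → f.coeff i * g.coeff j ∈ I) : (f * g).coeff m ∈ I := by
  rw [HahnSeries.coeff_mul]
  exact sum_mem fun ij hij => h _ _ (Finset.mem_antidiagonal.1 hij).2.2

theorem LaurentSeries.exists_nat_coeff_eq_zero (f : LaurentSeries A) :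
    ∃ d : ℕ, ∀ j : ℤ, j + d < 0 → f.coeff j = 0 :=
  ⟨f.order.natAbs, fun j hj => HahnSeries.coeff_eq_zero_of_lt_order (by omega)⟩

/-- If `A((x))` has bounded generators as a left module over itself, then `A` is left noetherian. -/
theorem isNoetherianRing_of_hasBoundedGenerators
    (h : HasBoundedGenerators (LaurentSeries A) (LaurentSeries A)) : IsNoetherianRing A := by
  obtain ⟨n, hn⟩ := h
  rw [isNoetherianRing_iff, isNoetherian_iff, RelEmbedding.wellFounded_iff_isEmpty]
  refine ⟨fun I => ?_⟩
  have hIlt : ∀ s, I s < I (s + 1) := fun s => I.map_rel_iff.2 (Nat.lt_succ_self s)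
  have hImono : Monotone I := monotone_nat_of_le_succ fun s => (hIlt s).le
  choose a haI haI' using fun s => SetLike.exists_of_lt (hIlt s)
  let f : ℕ → LaurentSeries A := fun i => HahnSeries.ofSuppBddBelow
    (fun m => if ((m.toNat.sqrt * m.toNat.sqrt : ℕ) : ℤ) = m ∧ m.toNat.sqrt % (n + 1) = i
      then a m.toNat.sqrt else 0)
    ⟨0, fun m hm => by
      simp only [Function.mem_support, ne_eq, ite_eq_right_iff, not_forall] at hm
      obtain ⟨⟨h, -⟩, -⟩ := hm
      rw [← h]
      positivity⟩
  have hf : ∀ i m, (f i).coeff m =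
      if ((m.toNat.sqrt * m.toNat.sqrt : ℕ) : ℤ) = m ∧ m.toNat.sqrt % (n + 1) = i
        then a m.toNat.sqrt else 0 := fun _ _ => rfl
  obtain ⟨i, hi, hmem⟩ := hn f
  let S : ℤ → Set A := fun m => a '' {s : ℕ | ((s * s : ℕ) : ℤ) ≤ m ∧ s % (n + 1) ≠ i}
  have hS : Monotone S := fun m m' h => Set.image_mono fun s hs => ⟨hs.1.trans h, hs.2⟩
  have key : ∀ g ∈ Submodule.span (LaurentSeries A) (f '' ((Finset.range (n + 1)).erase i)),
      ∃ d : ℕ, ∀ m, g.coeff m ∈ Submodule.span A (S (m + d)) := by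
    intro g hg
    induction hg using Submodule.span_induction with
    | mem g hg =>
      obtain ⟨j, hj, rfl⟩ := hg
      refine ⟨0, fun m => ?_⟩
      rw [hf]
      split_ifs with h
      · refine Submodule.subset_span ⟨_, ⟨by rw [h.1]; simp, ?_⟩, rfl⟩
        rw [h.2]
        exact Finset.ne_of_mem_erase hj
      · exact zero_mem _
    | zero => exact ⟨0, fun m => by simp⟩
    | add x y _ _ hx hy =>
      obtain ⟨d, hd⟩ := hx
      obtain ⟨d', hd'⟩ := hy
      refine ⟨d + d', fun m => add_mem ?_ ?_⟩
      · exact Submodule.span_mono (hS (by push_cast; omega)) (hd m)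
      · exact Submodule.span_mono (hS (by push_cast; omega)) (hd' m)
    | smul g x _ hx =>
      obtain ⟨d, hd⟩ := hx
      obtain ⟨d', hd'⟩ := g.exists_nat_coeff_eq_zero
      refine ⟨d + d', fun m => ?_⟩
      rw [smul_eq_mul]
      refine LaurentSeries.coeff_mul_mem _ ?_
      intro j k hjk
      by_cases hj : j + d' < 0
      · rw [hd' j hj, zero_mul]
        exact zero_mem _
      · refine Submodule.smul_mem _ _ (Submodule.span_mono (hS ?_) (hd k))
        push_cast
        omega
  obtain ⟨d, hd⟩ := key _ hmem
  have hi' : i < n + 1 := Finset.mem_range.1 hi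
  set s := i + (n + 1) * d with hs
  have hsi : s % (n + 1) = i := by simp [hs, Nat.mod_eq_of_lt hi']
  have hds : d ≤ s := by nlinarith
  have := hd ((s * s : ℕ) : ℤ)
  rw [hf, Int.toNat_natCast, Nat.sqrt_eq, if_pos ⟨rfl, hsi⟩] at this
  refine haI' s (Submodule.span_le.2 ?_ this)
  rintro _ ⟨t, ⟨ht, hti⟩, rfl⟩
  have hts : t < s := by
    refine lt_of_le_of_ne ?_ fun h => hti (h ▸ hsi)
    by_contra! hlt
    have : t * t ≤ s * s + d := by exact_mod_cast ht
    nlinarith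
  exact hImono hts (haI t)

theorem LaurentSeries.isUnit_ofPowerSeries {v : PowerSeries A}
    (hv : PowerSeries.constantCoeff v = 1) : IsUnit (HahnSeries.ofPowerSeries ℤ A v) :=
  IsUnit.map (HahnSeries.ofPowerSeries ℤ A) ⟨⟨v, PowerSeries.invOfUnit v 1,
    PowerSeries.mul_invOfUnit v 1 (by simpa using hv),
    PowerSeries.invOfUnit_mul v 1 (by simpa using hv)⟩, rfl⟩

theorem LaurentSeries.isUnit_single_one (i : ℤ) :
    IsUnit (HahnSeries.single i (1 : A) : LaurentSeries A) :=
  ⟨⟨HahnSeries.single i 1, HahnSeries.single (-i) 1, by simp [HahnSeries.single_mul_single],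
    by simp [HahnSeries.single_mul_single]⟩, rfl⟩

theorem LaurentSeries.isUnit_single_sub_single {i j : ℕ} (hij : i ≠ j) :
    IsUnit (HahnSeries.single (i : ℤ) (1 : A) - HahnSeries.single (j : ℤ) 1 : LaurentSeries A) := by
  wlog h : i < j generalizing i j
  · rw [← neg_sub]
    exact (this hij.symm (by omega)).neg
  obtain ⟨d, rfl⟩ := Nat.exists_eq_add_of_lt h
  have : (HahnSeries.single (i : ℤ) (1 : A) - HahnSeries.single ((i + d + 1 : ℕ) : ℤ) 1 :
      LaurentSeries A) = HahnSeries.single (i : ℤ) (1 : A) *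
        HahnSeries.ofPowerSeries ℤ A (1 - PowerSeries.X ^ (d + 1)) := by
    rw [map_sub, map_one (HahnSeries.ofPowerSeries ℤ A), HahnSeries.ofPowerSeries_X_pow, mul_sub, mul_one,
      HahnSeries.single_mul_single]
    simp [add_assoc]
  rw [this]
  exact (isUnit_single_one _).mul (isUnit_ofPowerSeries (by simp))

/-- If `C a - x ^ q` is left invertible in `A((x))` for some `q > 0`, then
`a ^ k ∈ A a ^ (k + 1)` for some `k`. -/
theorem exists_pow_eq_mul_pow_succ_of_mul_sub_single {a : A} {q : ℕ} (hq : 0 < q)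
    {g : LaurentSeries A}
    (hg : g * (HahnSeries.C a - HahnSeries.single (q : ℤ) 1) = 1) :
    ∃ (k : ℕ) (b : A), a ^ k = b * a ^ (k + 1) := by
  have hcoeff : ∀ m : ℤ, g.coeff (m - q) = g.coeff m * a - (1 : LaurentSeries A).coeff m := by
    intro m
    rw [← hg, mul_sub, HahnSeries.coeff_sub, HahnSeries.C_apply,
      HahnSeries.coeff_mul_single_zero, HahnSeries.coeff_mul_single, mul_one]
    abel
  have hneg : ∀ k : ℕ, g.coeff (-((k + 1 : ℕ) * q : ℤ)) = (g.coeff 0 * a - 1) * a ^ k := by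
    intro k
    induction k with
    | zero => simpa using hcoeff 0
    | succ k ih =>
      have hne : (-((k + 1 : ℕ) * q : ℤ)) ≠ 0 := by
        have : (0 : ℤ) < (k + 1 : ℕ) * q := by positivity
        omega
      have h := hcoeff (-((k + 1 : ℕ) * q : ℤ))
      rw [ih, HahnSeries.coeff_one, if_neg hne, sub_zero, mul_assoc, ← pow_succ] at h
      rw [← h]
      congr 1
      push_cast
      ring
  obtain ⟨d, hd⟩ := g.exists_nat_coeff_eq_zero
  refine ⟨d, g.coeff 0, ?_⟩
  have h := hneg d
  rw [hd _ (by push_cast; nlinarith), sub_mul, one_mul, eq_comm, sub_eq_zero, mul_assoc,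
    ← pow_succ'] at h
  exact h.symm

open Polynomial in
/-- If `A((x))` has bounded generators as a left module over itself, then `A` is left
π-regular. -/
theorem exists_pow_eq_mul_pow_succ_of_hasBoundedGenerators
    (h : HasBoundedGenerators (LaurentSeries A) (LaurentSeries A)) (a : A) :
    ∃ (k : ℕ) (b : A), a ^ k = b * a ^ (k + 1) := by
  classical
  obtain ⟨n, hn⟩ := h
  let ψ : ℤ[X] →+* LaurentSeries A :=
    (aeval (R := ℤ) (HahnSeries.single (1 : ℤ) (1 : A) : LaurentSeries A)).toRingHom
  have hψ : ∀ k : ℕ, ψ (X ^ k) = HahnSeries.single (k : ℤ) 1 := fun k => by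
    rw [map_pow]
    change (aeval _ X) ^ k = _
    rw [aeval_X, HahnSeries.single_pow]
    simp
  have hcomm : ∀ p, Commute (ψ p) (HahnSeries.C a) := by
    intro p
    induction p using Polynomial.induction_on' with
    | add p q hp hq => rw [map_add]; exact hp.add_left hq
    | monomial k c =>
      rw [← C_mul_X_pow_eq_monomial, map_mul, hψ]
      refine Commute.mul_left ?_ ?_
      · rw [eq_intCast C c, map_intCast]
        exact Int.cast_commute _ _
      · rw [Commute, SemiconjBy, HahnSeries.C_apply, HahnSeries.single_mul_single,
          HahnSeries.single_mul_single]
        simp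
  let φ : ℤ[X][X] →+* LaurentSeries A := eval₂RingHom' ψ (HahnSeries.C a) hcomm
  have hφC : ∀ p, φ (C p) = ψ p := fun p => eval₂_C _ _
  have hφX : φ X = HahnSeries.C a := eval₂_X _ _
  let q : ℕ → ℤ[X][X] := fun i => X - C (X ^ (i + 1))
  obtain ⟨i, hi, hmem⟩ := hn fun i => φ (∏ j ∈ (Finset.range (n + 1)).erase i, q j)
  have hle : Submodule.span (LaurentSeries A)
      ((fun i => φ (∏ j ∈ (Finset.range (n + 1)).erase i, q j)) ''
        ((Finset.range (n + 1)).erase i)) ≤ Ideal.span {φ (q i)} := by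
    rw [Submodule.span_le]
    rintro _ ⟨j, hj, rfl⟩
    obtain ⟨p, hp⟩ : q i ∣ ∏ l ∈ (Finset.range (n + 1)).erase j, q l :=
      Finset.dvd_prod_of_mem _ (Finset.mem_erase.2 ⟨(Finset.ne_of_mem_erase hj).symm, hi⟩)
    refine Ideal.mem_span_singleton'.2 ⟨φ p, ?_⟩
    rw [← map_mul, mul_comm p, ← hp]
  replace hmem := hle hmem
  obtain ⟨p, hp⟩ := X_sub_C_dvd_sub_C_eval (a := (X ^ (i + 1) : ℤ[X]))
    (p := ∏ j ∈ (Finset.range (n + 1)).erase i, q j)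
  have hunit : ψ (∏ j ∈ (Finset.range (n + 1)).erase i, (X ^ (i + 1) - X ^ (j + 1))) ∈
      Ideal.span {φ (q i)} := by
    have : C (∏ j ∈ (Finset.range (n + 1)).erase i, (X ^ (i + 1) - X ^ (j + 1) : ℤ[X])) =
        (∏ j ∈ (Finset.range (n + 1)).erase i, q j) - p * q i := by
      rw [mul_comm p, ← hp, eval_prod, sub_sub_cancel]
      simp [q]
    rw [← hφC, this, map_sub φ (∏ j ∈ _, q j), map_mul]
    exact sub_mem hmem (Ideal.mul_mem_left _ _ (Ideal.mem_span_singleton_self _))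
  have hisUnit : ∀ s : Finset ℕ, i ∉ s → IsUnit (ψ (∏ j ∈ s, (X ^ (i + 1) - X ^ (j + 1)))) := by
    intro s
    induction s using Finset.induction_on with
    | empty => simp
    | insert j s hj ih =>
      intro his
      rw [Finset.prod_insert hj, map_mul]
      refine IsUnit.mul ?_ (ih fun h => his (Finset.mem_insert_of_mem h))
      rw [map_sub, hψ, hψ]
      refine LaurentSeries.isUnit_single_sub_single fun h => his ?_
      rw [show i = j by omega]
      exact Finset.mem_insert_self _ _
  have htop := Ideal.eq_top_of_isUnit_mem _ hunit (hisUnit _ (by simp))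
  obtain ⟨g, hg⟩ := Ideal.mem_span_singleton'.1 ((Ideal.eq_top_iff_one _).1 htop)
  refine exists_pow_eq_mul_pow_succ_of_mul_sub_single (Nat.succ_pos i) (g := g) ?_
  rw [← hg]
  simp only [q]
  rw [map_sub, hφX, hφC, hψ]

theorem isArtinianRing_of_hasBoundedGenerators
    (h : HasBoundedGenerators (LaurentSeries A) (LaurentSeries A)) : IsArtinianRing A :=
  have := isNoetherianRing_of_hasBoundedGenerators h
  isArtinianRing_of_pow_eq (exists_pow_eq_mul_pow_succ_of_hasBoundedGenerators h)

/-- The left ideal of `A((x))` of all series with coefficients in the left ideal `B` of `A`. -/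
def Ideal.laurent (B : Ideal A) : Ideal (LaurentSeries A) where
  carrier := {f | ∀ j, f.coeff j ∈ B}
  add_mem' hf hg j := add_mem (hf j) (hg j)
  zero_mem' _ := zero_mem _
  smul_mem' g f hf j := by
    rw [smul_eq_mul]
    exact LaurentSeries.coeff_mul_mem _ fun i k _ => B.mul_mem_left _ (hf k)

theorem Ideal.mem_laurent {B : Ideal A} {f : LaurentSeries A} :
    f ∈ B.laurent ↔ ∀ j, f.coeff j ∈ B := Iff.rfl

theorem Ideal.C_mem_laurent {B : Ideal A} {b : A} :
    (HahnSeries.C b : LaurentSeries A) ∈ B.laurent ↔ b ∈ B := by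
  refine ⟨fun h => by simpa using h 0, fun h j => ?_⟩
  rw [HahnSeries.C_apply, HahnSeries.coeff_single]
  split_ifs
  exacts [h, zero_mem _]

theorem Ideal.laurent_le_laurent_iff {B C : Ideal A} : B.laurent ≤ C.laurent ↔ B ≤ C :=
  ⟨fun h _ hb => C_mem_laurent.1 (h (C_mem_laurent.2 hb)), fun h _ hf j => h (hf j)⟩

theorem Ideal.mul_mem_laurent {I K : Ideal A} {f g : LaurentSeries A} (hf : f ∈ I.laurent)
    (hg : g ∈ K.laurent) : f * g ∈ (I * K).laurent := fun _ =>
  LaurentSeries.coeff_mul_mem _ fun i j _ => Ideal.mul_mem_mul (hf i) (hg j)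

theorem Ideal.isNilpotent_of_mem_laurent {J : Ideal A} (hJ : IsNilpotent J) {f : LaurentSeries A}
    (hf : f ∈ J.laurent) : IsNilpotent f := by
  have hpow : ∀ k, f ^ k ∈ (J ^ k).laurent := by
    intro k
    induction k with
    | zero => rw [Submodule.pow_zero, Ideal.one_eq_top]; exact fun _ => Submodule.mem_top
    | succ k ih =>
      rw [pow_succ, Submodule.pow_succ]
      exact mul_mem_laurent ih hf
  obtain ⟨k, hk⟩ := hJ
  refine ⟨k, HahnSeries.ext (funext fun j => ?_)⟩
  have := hpow k j
  rw [hk] at this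
  exact this

/-- A Laurent series whose first coefficient outside a nilpotent ideal is `1` is a unit. -/
theorem LaurentSeries.isUnit_of_coeff {J : Ideal A} (hJ : IsNilpotent J) {h : LaurentSeries A}
    {p : ℤ} (hlt : ∀ j < p, h.coeff j ∈ J) (hp : h.coeff p = 1) : IsUnit h := by
  let v : PowerSeries A := PowerSeries.mk fun n => h.coeff (p + n)
  have hu : IsUnit (HahnSeries.single p (1 : A) * HahnSeries.ofPowerSeries ℤ A v) :=
    (isUnit_single_one p).mul (isUnit_ofPowerSeries (by simp [v, hp]))
  obtain ⟨u, hu⟩ := hu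
  have hmem : h - u ∈ J.laurent := by
    intro m
    rw [HahnSeries.coeff_sub, hu, HahnSeries.coeff_single_mul, one_mul, PowerSeries.coeff_coe]
    split_ifs with hm
    · rw [sub_zero]
      exact hlt m (by omega)
    · have : p + ((m - p).natAbs : ℤ) = m := by omega
      rw [PowerSeries.coeff_mk, this, sub_self]
      exact zero_mem _
  have : h = u * (1 + ↑u⁻¹ * (h - u)) := by
    rw [mul_add, ← mul_assoc, Units.mul_inv, mul_one, one_mul, add_sub_cancel]
  rw [this]
  exact u.isUnit.mul
    (Ideal.isNilpotent_of_mem_laurent hJ (J.laurent.mul_mem_left _ hmem)).isUnit_one_add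

theorem LaurentSeries.exists_eq_mul_C {P : ℤ → A → Prop} {f : LaurentSeries A} {m : A}
    (h : ∀ j, ∃ c, P j c ∧ f.coeff j = c * m ∧ (f.coeff j = 0 → c = 0)) :
    ∃ g : LaurentSeries A, f = g * HahnSeries.C m ∧ ∀ j, P j (g.coeff j) := by
  choose c hP hc h0 using h
  refine ⟨HahnSeries.mk c (f.isPWO_support.mono fun j hj h => hj (h0 j h)), ?_, hP⟩
  ext j
  rw [HahnSeries.C_apply, HahnSeries.coeff_mul_single_zero, hc]

theorem Ideal.laurent_le_span_C {N : Ideal A} {m : A} (hN : N ≤ span {m}) :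
    N.laurent ≤ span {HahnSeries.C m} := by
  classical
  intro f hf
  obtain ⟨g, rfl, -⟩ := LaurentSeries.exists_eq_mul_C (P := fun _ _ => True) (f := f) (m := m) <| by
    intro j
    by_cases h0 : f.coeff j = 0
    · exact ⟨0, trivial, by simp [h0], fun _ => rfl⟩
    · obtain ⟨c, hc⟩ := Ideal.mem_span_singleton'.1 (hN (hf j))
      exact ⟨c, trivial, hc.symm, fun h => absurd h h0⟩
  exact Ideal.mul_mem_left _ _ (Ideal.mem_span_singleton_self _)

/-- A proper left subideal of a hollow principal left ideal `A m` lies in `J m`, where `J` is the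
Jacobson radical. -/
theorem exists_mem_jacobson_eq_mul_of_supIrred [IsSemisimpleRing (A ⧸ Ring.jacobson A)]
    {m n : A} (hN : SupIrred (Ideal.span {m})) (hn : n ∈ Ideal.span {m})
    (hne : Ideal.span {n} ≠ Ideal.span {m}) : ∃ c ∈ Ring.jacobson A, n = c * m := by
  let ρ : A →ₗ[A] A := LinearMap.toSpanSingleton A A m
  have hρ : ∀ a, ρ a = a * m := fun a => rfl
  let L : Ideal A := Submodule.comap ρ (Ideal.span {n})
  have hmk : Function.Surjective (Ideal.Quotient.mk (Ring.jacobson A)) :=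
    Ideal.Quotient.mk_surjective
  obtain ⟨D, hdisj, hcodisj⟩ := exists_isCompl (L.map (Ideal.Quotient.mk (Ring.jacobson A)))
  let C : Ideal A := D.comap (Ideal.Quotient.mk (Ring.jacobson A))
  have hinf : ∀ x ∈ L, x ∈ C → x ∈ Ring.jacobson A := by
    intro x hxL hxC
    rw [← Ideal.Quotient.eq_zero_iff_mem]
    exact Submodule.disjoint_def.1 hdisj _ (Ideal.mem_map_of_mem _ hxL) hxC
  obtain ⟨l, hl, c, hc, hlc⟩ : ∃ l ∈ L, ∃ c ∈ C, l + c = 1 := by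
    have : (1 : A ⧸ Ring.jacobson A) ∈ L.map (Ideal.Quotient.mk (Ring.jacobson A)) ⊔ D := by
      rw [codisjoint_iff.1 hcodisj]
      trivial
    obtain ⟨x, hx, d, hd, hxd⟩ := Submodule.mem_sup.1 this
    obtain ⟨l, hl, rfl⟩ := (Ideal.mem_map_iff_of_surjective _ hmk).1 hx
    refine ⟨l, hl, 1 - l, ?_, by abel⟩
    change Ideal.Quotient.mk (Ring.jacobson A) (1 - l) ∈ D
    rw [map_sub, map_one, ← hxd, add_sub_cancel_left]
    exact hd
  have hsup : Ideal.span {n} ⊔ Submodule.map ρ C = Ideal.span {m} := by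
    apply le_antisymm
    · refine sup_le ((Ideal.span_singleton_le_iff_mem _).2 hn) ?_
      rintro _ ⟨a, -, rfl⟩
      exact Ideal.mem_span_singleton'.2 ⟨a, rfl⟩
    · rw [Ideal.span_singleton_le_iff_mem, ← one_mul m, ← hlc, add_mul]
      exact add_mem (Ideal.mem_sup_left hl) (Ideal.mem_sup_right ⟨c, hc, rfl⟩)
  have hC := (hN.2 hsup).resolve_left hne
  obtain ⟨c, hc, hcm⟩ : m ∈ Submodule.map ρ C := hC ▸ Ideal.mem_span_singleton_self m
  rw [hρ] at hcm
  obtain ⟨a, rfl⟩ := Ideal.mem_span_singleton'.1 hn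
  have hac : a * c * m = a * m := by rw [mul_assoc, hcm]
  refine ⟨a * c, hinf _ ?_ (C.mul_mem_left _ hc), hac.symm⟩
  change a * c * m ∈ Ideal.span {a * m}
  rw [hac]
  exact Ideal.mem_span_singleton_self _

/-- A series with coefficients in a hollow left ideal `N`, one of which generates `N`, generates
`N((x))`. -/
theorem Ideal.laurent_le_span_of_supIrred [IsSemiprimaryRing A] {N : Ideal A} (hN : SupIrred N)
    {f : LaurentSeries A} (hf : f ∈ N.laurent) (hgen : ∃ j, span {f.coeff j} = N) :
    N.laurent ≤ span {f} := by
  have := IsSemiprimaryRing.isSemisimpleRing (R := A)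
  have hbot : N ≠ ⊥ := hN.ne_bot
  obtain ⟨d, hd⟩ := f.exists_nat_coeff_eq_zero
  obtain ⟨p, rfl, hmin⟩ := Int.exists_least_of_bdd (P := fun j => span {f.coeff j} = N)
    ⟨-d, fun j hj => by
      by_contra h
      rw [hd j (by omega)] at hj
      simp [← hj] at hbot⟩ hgen
  have hp0 : f.coeff p ≠ 0 := fun h => by simp [h] at hbot
  obtain ⟨g, hg, hg'⟩ := LaurentSeries.exists_eq_mul_C (f := f) (m := f.coeff p)
    (P := fun j c => (j < p → c ∈ Ring.jacobson A) ∧ (j = p → c = 1)) <| by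
      intro j
      by_cases h0 : f.coeff j = 0
      · exact ⟨0, ⟨fun _ => zero_mem _, fun h => absurd (h ▸ h0) hp0⟩, by simp [h0], fun _ => rfl⟩
      rcases lt_trichotomy j p with h | rfl | h
      · obtain ⟨c, hc, hcm⟩ := exists_mem_jacobson_eq_mul_of_supIrred hN (hf j)
          fun h' => (hmin j h').not_gt h
        exact ⟨c, ⟨fun _ => hc, fun h' => absurd h' h.ne⟩, hcm, fun h => absurd h h0⟩
      · exact ⟨1, ⟨fun h => absurd h (lt_irrefl _), fun _ => rfl⟩, by simp, fun h => absurd h h0⟩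
      · obtain ⟨c, hc⟩ := Ideal.mem_span_singleton'.1 (hf j)
        exact ⟨c, ⟨fun h' => absurd h' h.not_gt, fun h' => absurd h' h.ne'⟩, hc.symm,
          fun h => absurd h h0⟩
  obtain ⟨u, hu⟩ := LaurentSeries.isUnit_of_coeff IsSemiprimaryRing.isNilpotent
    (fun j => (hg' j).1) ((hg' p).2 rfl)
  refine (laurent_le_span_C le_rfl).trans ?_
  rw [span_singleton_le_iff_mem]
  refine mem_span_singleton'.2 ⟨↑u⁻¹, ?_⟩
  rw [Units.inv_mul_eq_iff_eq_mul, hu, ← hg]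

theorem isUniserialModule_submodule_iff {R M : Type*} [Ring R] [AddCommGroup M] [Module R M]
    {N : Submodule R M} :
    IsUniserialModule R N ↔ ∀ B ≤ N, ∀ C ≤ N, B ≤ C ∨ C ≤ B := by
  refine ⟨fun h B hB C hC => ?_, fun h B C => ?_⟩
  · have := h (B.comap N.subtype) (C.comap N.subtype)
    rwa [← Submodule.map_le_map_iff_of_injective N.subtype_injective,
      ← Submodule.map_le_map_iff_of_injective N.subtype_injective,
      Submodule.map_comap_eq_self (by simpa using hB),
      Submodule.map_comap_eq_self (by simpa using hC)] at this
  · rw [← Submodule.map_le_map_iff_of_injective N.subtype_injective,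
      ← Submodule.map_le_map_iff_of_injective N.subtype_injective]
    exact h _ (Submodule.map_subtype_le _ _) _ (Submodule.map_subtype_le _ _)

theorem IsUniserialModule.supIrred {R M : Type*} [Ring R] [AddCommGroup M] [Module R M]
    {N B : Submodule R M} (hN : IsUniserialModule R N) (hB : B ≤ N) (h0 : B ≠ ⊥) : SupIrred B := by
  refine ⟨by simpa using h0, fun C D h => ?_⟩
  have hC : C ≤ B := h ▸ le_sup_left
  have hD : D ≤ B := h ▸ le_sup_right
  rcases isUniserialModule_submodule_iff.1 hN C (hC.trans hB) D (hD.trans hB) with h' | h'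
  · rw [sup_of_le_right h'] at h
    exact Or.inr h
  · rw [sup_of_le_left h'] at h
    exact Or.inl h

@[simp]
theorem Ideal.laurent_bot : (⊥ : Ideal A).laurent = ⊥ :=
  le_bot_iff.1 fun _ hf => HahnSeries.ext (funext hf)

@[simp]
theorem Ideal.laurent_top : (⊤ : Ideal A).laurent = ⊤ :=
  top_le_iff.1 fun _ _ _ => Submodule.mem_top

theorem Ideal.disjoint_laurent {B C : Ideal A} (h : Disjoint B C) :
    Disjoint B.laurent C.laurent :=
  Submodule.disjoint_def.2 fun _ hB hC =>
    HahnSeries.ext (funext fun j => Submodule.disjoint_def.1 h _ (hB j) (hC j))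

theorem Ideal.laurent_sup (B C : Ideal A) : (B ⊔ C).laurent = B.laurent ⊔ C.laurent := by
  refine le_antisymm (fun f hf => ?_) (sup_le (laurent_le_laurent_iff.2 le_sup_left)
    (laurent_le_laurent_iff.2 le_sup_right))
  have key : ∀ j, ∃ b ∈ B, ∃ c ∈ C, b + c = f.coeff j ∧ (f.coeff j = 0 → b = 0) := by
    intro j
    by_cases h0 : f.coeff j = 0
    · exact ⟨0, zero_mem _, 0, zero_mem _, by simp [h0], fun _ => rfl⟩
    · obtain ⟨b, hb, c, hc, h⟩ := Submodule.mem_sup.1 (hf j)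
      exact ⟨b, hb, c, hc, h, fun h => absurd h h0⟩
  choose b hb c hc hbc h0 using key
  let g : LaurentSeries A := HahnSeries.mk b (f.isPWO_support.mono fun j hj h => hj (h0 j h))
  refine Submodule.mem_sup.2 ⟨g, hb, f - g, fun j => ?_, add_sub_cancel _ _⟩
  rw [HahnSeries.coeff_sub, ← hbc j]
  change b j + c j - b j ∈ C
  rw [add_sub_cancel_left]
  exact hc j

theorem Ideal.laurent_iSup {ι : Type*} [Fintype ι] (N : ι → Ideal A) :
    (⨆ i, N i).laurent = ⨆ i, (N i).laurent := by
  rw [← Finset.sup_univ_eq_iSup, ← Finset.sup_univ_eq_iSup]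
  exact Finset.apply_sup_eq_sup_comp _ laurent_sup laurent_bot

theorem Ideal.iSupIndep_laurent {ι : Type*} {N : ι → Ideal A} (h : iSupIndep N) :
    iSupIndep fun i => (N i).laurent := fun i =>
  (disjoint_laurent (h i)).mono_right
    (iSup₂_le fun j hj => laurent_le_laurent_iff.2 (le_iSup₂_of_le j hj le_rfl))

/-- The left ideal of `A` generated by the coefficients of the series in `K`. -/
def Ideal.laurentCoeffs (K : Ideal (LaurentSeries A)) : Ideal A :=
  Ideal.span {a | ∃ f ∈ K, ∃ j, f.coeff j = a}

theorem Ideal.coeff_mem_laurentCoeffs {K : Ideal (LaurentSeries A)} {f : LaurentSeries A}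
    (hf : f ∈ K) (j : ℤ) : f.coeff j ∈ K.laurentCoeffs :=
  Ideal.subset_span ⟨f, hf, j, rfl⟩

theorem Ideal.laurentCoeffs_le_iff {K : Ideal (LaurentSeries A)} {B : Ideal A} :
    K.laurentCoeffs ≤ B ↔ K ≤ B.laurent := by
  refine ⟨fun h f hf j => h (coeff_mem_laurentCoeffs hf j), fun h => Ideal.span_le.2 ?_⟩
  rintro _ ⟨f, hf, j, rfl⟩
  exact h hf j

theorem Ideal.laurentCoeffs_mono {K L : Ideal (LaurentSeries A)} (h : K ≤ L) :
    K.laurentCoeffs ≤ L.laurentCoeffs :=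
  laurentCoeffs_le_iff.2 (h.trans (laurentCoeffs_le_iff.1 le_rfl))

theorem Ideal.laurent_laurentCoeffs [IsSemiprimaryRing A] [IsNoetherianRing A] {N : Ideal A}
    (hN : IsUniserialModule A N) {K : Ideal (LaurentSeries A)} (hK : K ≤ N.laurent) :
    K.laurentCoeffs.laurent = K := by
  refine le_antisymm ?_ (laurentCoeffs_le_iff.1 le_rfl)
  by_cases h0 : K.laurentCoeffs = ⊥
  · rw [h0, laurent_bot]
    exact bot_le
  have hKN : K.laurentCoeffs ≤ N := laurentCoeffs_le_iff.2 hK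
  obtain ⟨_, ⟨f, hf, j, rfl⟩, hmax⟩ := WellFounded.has_min
    (wellFounded_gt : WellFounded ((· > ·) : Ideal A → Ideal A → Prop))
    {B | ∃ f ∈ K, ∃ j, span {f.coeff j} = B} ⟨_, 0, K.zero_mem, 0, rfl⟩
  have hle : ∀ g ∈ K, ∀ i, span {g.coeff i} ≤ N := fun g hg i =>
    (span_singleton_le_iff_mem _).2 (hKN (coeff_mem_laurentCoeffs hg i))
  have hgen : span {f.coeff j} = K.laurentCoeffs := by
    refine le_antisymm ((span_singleton_le_iff_mem _).2 (coeff_mem_laurentCoeffs hf j)) ?_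
    refine span_le.2 ?_
    rintro _ ⟨g, hg, i, rfl⟩
    change g.coeff i ∈ span {f.coeff j}
    rw [← span_singleton_le_iff_mem]
    rcases isUniserialModule_submodule_iff.1 hN _ (hle g hg i) _ (hle f hf j) with h | h
    · exact h
    · by_contra hcon
      exact hmax _ ⟨g, hg, i, rfl⟩ (lt_of_le_not_ge h hcon)
  exact (laurent_le_span_of_supIrred (hN.supIrred hKN h0) (laurentCoeffs_le_iff.1 le_rfl hf)
    ⟨j, hgen⟩).trans ((span_singleton_le_iff_mem _).2 hf)

theorem IsUniserialModule.laurent [IsArtinianRing A] {N : Ideal A}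
    (hN : IsUniserialModule A N) : IsUniserialModule (LaurentSeries A) N.laurent := by
  rw [isUniserialModule_submodule_iff]
  intro K hK L hL
  rw [← Ideal.laurent_laurentCoeffs hN hK, ← Ideal.laurent_laurentCoeffs hN hL,
    Ideal.laurent_le_laurent_iff, Ideal.laurent_le_laurent_iff]
  exact isUniserialModule_submodule_iff.1 hN _ (Ideal.laurentCoeffs_le_iff.2 hK) _
    (Ideal.laurentCoeffs_le_iff.2 hL)

theorem isArtinian_laurent_of_isUniserialModule [IsArtinianRing A] {N : Ideal A}
    (hN : IsUniserialModule A N) : IsArtinian (LaurentSeries A) N.laurent := by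
  let F : Submodule (LaurentSeries A) N.laurent → Ideal A := fun K =>
    Ideal.laurentCoeffs (K.map N.laurent.subtype)
  have hmono : Monotone F := fun K L h => Ideal.laurentCoeffs_mono (Submodule.map_mono h)
  have hinj : Function.Injective F := by
    intro K L h
    have := congrArg Ideal.laurent h
    rw [Ideal.laurent_laurentCoeffs hN (Submodule.map_subtype_le _ _),
      Ideal.laurent_laurentCoeffs hN (Submodule.map_subtype_le _ _)] at this
    exact Submodule.map_injective_of_injective N.laurent.subtype_injective this
  exact (hmono.strictMono_of_injective hinj).wellFoundedLT

theorem IsLeftSerialRing.laurentSeries [IsArtinianRing A] (h : IsLeftSerialRing A) :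
    IsLeftSerialRing (LaurentSeries A) ∧ IsArtinianRing (LaurentSeries A) := by
  obtain ⟨ι, _, N, hind, htop, hN⟩ := h
  have htop' : ⨆ i, Ideal.laurent (N i) = ⊤ := by rw [← Ideal.laurent_iSup, htop, Ideal.laurent_top]
  refine ⟨⟨ι, inferInstance, _, Ideal.iSupIndep_laurent hind, htop', fun i => (hN i).laurent⟩, ?_⟩
  have := fun i => isArtinian_laurent_of_isUniserialModule (hN i)
  have h := isArtinian_iSup (R := LaurentSeries A) (M := fun i => Ideal.laurent (N i))
  rw [htop'] at h
  exact Submodule.topEquiv.isArtinian_iff.1 h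

/-- The left ideal `N` contains a right identity for itself, i.e. it is generated by an
idempotent. -/
def Ideal.HasRightIdentity (N : Ideal A) : Prop := ∃ e ∈ N, ∀ n ∈ N, n * e = n

theorem Ideal.HasRightIdentity.of_isCompl {N B D : Ideal A} (hN : N.HasRightIdentity)
    (hsup : B ⊔ D = N) (hdisj : Disjoint B D) : B.HasRightIdentity := by
  obtain ⟨e, heN, he⟩ := hN
  obtain ⟨b, hb, d, hd, rfl⟩ := Submodule.mem_sup.1 (hsup ▸ heN)
  refine ⟨b, hb, fun n hn => ?_⟩
  have h : n * b + n * d = n := by rw [← mul_add]; exact he n (hsup ▸ Ideal.mem_sup_left hn)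
  have : n * d ∈ B := by
    rw [eq_sub_of_add_eq' h]
    exact sub_mem hn (B.mul_mem_left _ hb)
  rw [Submodule.disjoint_def.1 hdisj _ this (D.mul_mem_left _ hd), add_zero] at h
  exact h

/-- Over a left artinian ring, a left ideal generated by an idempotent is hollow or
decomposable. -/
theorem Ideal.HasRightIdentity.supIrred_or_exists_isCompl [IsArtinianRing A] {N : Ideal A}
    (hN : N.HasRightIdentity) (h0 : N ≠ ⊥) :
    SupIrred N ∨ ∃ B D, B ⊔ D = N ∧ Disjoint B D ∧ B < N ∧ D < N := by
  refine or_iff_not_imp_left.2 fun hirr => ?_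
  obtain ⟨B, C, hBC, hB, hC⟩ : ∃ B C, B ⊔ C = N ∧ B ≠ N ∧ C ≠ N := by
    by_contra! h
    exact hirr ⟨by simpa using h0, fun B C hBC => or_iff_not_imp_left.2 (h B C hBC)⟩
  obtain ⟨e, heN, he⟩ := hN
  have hBN : B ≤ N := hBC ▸ le_sup_left
  have hCN : C ≤ N := hBC ▸ le_sup_right
  obtain ⟨b, hb, c, hc, hbc⟩ := Submodule.mem_sup.1 (hBC ▸ heN)
  let φ : Module.End A N := (LinearMap.toSpanSingleton A N ⟨b, hBN hb⟩).comp N.subtype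
  have hφ : ∀ n, (φ n : A) = n * b := fun n => rfl
  obtain ⟨k, hk, hk0⟩ :=
    (φ.eventually_isCompl_ker_pow_range_pow.and (Filter.eventually_gt_atTop 0)).exists
  refine ⟨(φ ^ k).ker.map N.subtype, (φ ^ k).range.map N.subtype, ?_, ?_,
    lt_of_le_of_ne (Submodule.map_subtype_le _ _) fun h => hC ?_,
    lt_of_le_of_lt (b := B) ?_ (lt_of_le_of_ne hBN hB)⟩
  · rw [← Submodule.map_sup, hk.sup_eq_top, Submodule.map_top, Submodule.range_subtype]
  · exact Submodule.disjoint_map N.subtype_injective hk.disjoint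
  · have hker : (φ ^ k).ker = ⊤ := Submodule.map_injective_of_injective N.subtype_injective
      (by rw [h, Submodule.map_top, Submodule.range_subtype])
    have hnil : IsNilpotent φ := ⟨k, LinearMap.ker_eq_top.1 hker⟩
    refine le_antisymm hCN fun n hn => ?_
    obtain ⟨m, hm⟩ := ((Module.End.isUnit_iff _).1 hnil.isUnit_one_sub).2 ⟨n, hn⟩
    have hm' : (m : A) - m * b = n := congrArg Subtype.val hm
    rw [← hm', sub_eq_of_eq_add' (b := m * b) (c := m * c) (by rw [← mul_add, hbc, he m m.2])]
    exact C.mul_mem_left _ hc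
  · rintro _ ⟨x, ⟨y, rfl⟩, rfl⟩
    obtain ⟨j, rfl⟩ := Nat.exists_eq_succ_of_ne_zero hk0.ne'
    rw [pow_succ']
    exact B.mul_mem_left _ hb

theorem Ideal.HasRightIdentity.exists_supIndep [IsArtinianRing A] (N : Ideal A) :
    N.HasRightIdentity → ∃ s : Finset (Ideal A), s.SupIndep id ∧ s.sup id = N ∧
      ∀ B ∈ s, SupIrred B ∧ B.HasRightIdentity := by
  classical
  induction N using WellFoundedLT.induction with
  | ind N ih =>
  intro hN
  by_cases h0 : N = ⊥
  · exact ⟨∅, by simp, by simp [h0], by simp⟩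
  rcases hN.supIrred_or_exists_isCompl h0 with h | ⟨B, D, hsup, hdisj, hB, hD⟩
  · exact ⟨{N}, Finset.supIndep_singleton _ _, by simp, by simp [h, hN]⟩
  · obtain ⟨s, hs, rfl, hs'⟩ := ih B hB (hN.of_isCompl hsup hdisj)
    obtain ⟨t, ht, rfl, ht'⟩ := ih D hD (hN.of_isCompl (sup_comm _ D ▸ hsup) hdisj.symm)
    refine ⟨s ∪ t, hs.union ht hdisj, by rw [Finset.sup_union, hsup], fun B hB => ?_⟩
    exact (Finset.mem_union.1 hB).elim (hs' B) (ht' B)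

theorem IsUniserialModule.map {R M M' : Type*} [Ring R] [AddCommGroup M] [Module R M]
    [AddCommGroup M'] [Module R M'] {U : Submodule R M} (hU : IsUniserialModule R U)
    (φ : M →ₗ[R] M') : IsUniserialModule R (U.map φ) := by
  rw [isUniserialModule_submodule_iff] at hU ⊢
  have key : ∀ B ≤ U.map φ, (U ⊓ B.comap φ).map φ = B := by
    intro B hB
    refine le_antisymm ?_ fun b hb => ?_
    · rintro _ ⟨x, hx, rfl⟩
      exact hx.2
    · obtain ⟨x, hx, rfl⟩ := hB hb
      exact ⟨x, ⟨hx, hb⟩, rfl⟩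
  intro B hB C hC
  rw [← key B hB, ← key C hC]
  exact (hU _ inf_le_left _ inf_le_left).imp (Submodule.map_mono ·) (Submodule.map_mono ·)

/-- A hollow left ideal generated by an idempotent is uniserial if `A((x))` is a sum of uniserial
left ideals. -/
theorem isUniserialModule_of_supIrred [IsArtinianRing A] {ι : Type*}
    {U : ι → Ideal (LaurentSeries A)} (htop : ⨆ i, U i = ⊤)
    (hU : ∀ i, IsUniserialModule (LaurentSeries A) (U i)) {N : Ideal A} (hN : SupIrred N)
    (he : N.HasRightIdentity) : IsUniserialModule A N := by
  obtain ⟨e, heN, he⟩ := he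
  have hspan : Ideal.span {e} = N := by
    refine le_antisymm ((Ideal.span_singleton_le_iff_mem _).2 heN) fun n hn => ?_
    exact Ideal.mem_span_singleton'.2 ⟨n, he n hn⟩
  let φ : LaurentSeries A →ₗ[LaurentSeries A] LaurentSeries A :=
    LinearMap.toSpanSingleton _ _ (HahnSeries.C e)
  have hrange : ⨆ i, Submodule.map φ (U i) = N.laurent := by
    rw [← Submodule.map_iSup, htop, Submodule.map_top]
    apply le_antisymm
    · rintro _ ⟨r, rfl⟩
      exact N.laurent.mul_mem_left _ (Ideal.C_mem_laurent.2 heN)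
    · intro g hg
      refine ⟨g, HahnSeries.ext (funext fun j => ?_)⟩
      change (g * HahnSeries.C e).coeff j = g.coeff j
      rw [HahnSeries.C_apply, HahnSeries.coeff_mul_single_zero, he _ (hg j)]
  have hle : ∀ i, Submodule.map φ (U i) ≤ N.laurent := fun i => hrange ▸ le_iSup (fun i => Submodule.map φ (U i)) i
  obtain ⟨i, f, hf, j, hgen⟩ : ∃ i, ∃ f ∈ Submodule.map φ (U i), ∃ j, Ideal.span {f.coeff j} = N := by
    by_contra! hcon
    let K : Ideal A := Submodule.map (LinearMap.toSpanSingleton A A e) (Ring.jacobson A)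
    have hK : N.laurent ≤ K.laurent := by
      rw [← hrange]
      refine iSup_le fun i f hf j => ?_
      have hfj := hle i hf j
      have hne := hcon i f hf j
      rw [← hspan] at hN hfj hne
      obtain ⟨c, hc, h⟩ := exists_mem_jacobson_eq_mul_of_supIrred hN hfj hne
      exact ⟨c, hc, h.symm⟩
    obtain ⟨c, hc, hce⟩ := Ideal.laurent_le_laurent_iff.1 hK heN
    obtain ⟨k, hk⟩ := IsSemiprimaryRing.isNilpotent (R := A)
    have hnil : IsNilpotent c := ⟨k, by
      have := Ideal.pow_mem_pow hc k
      rwa [hk] at this⟩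
    have he0 : e = 0 := by
      rw [← hnil.isUnit_one_sub.mul_right_eq_zero, sub_mul, one_mul, sub_eq_zero]
      exact hce.symm
    exact hN.ne_bot (by rw [← hspan, he0]; simp)
  have heq : Submodule.map φ (U i) = N.laurent := le_antisymm (hle i)
    ((Ideal.laurent_le_span_of_supIrred hN (hle i hf) ⟨j, hgen⟩).trans
      ((Ideal.span_singleton_le_iff_mem _).2 hf))
  have := (hU i).map φ
  rw [heq, isUniserialModule_submodule_iff] at this
  rw [isUniserialModule_submodule_iff]
  intro B hB C hC
  rw [← Ideal.laurent_le_laurent_iff, ← Ideal.laurent_le_laurent_iff (B := C)]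
  exact this _ (Ideal.laurent_le_laurent_iff.2 hB) _ (Ideal.laurent_le_laurent_iff.2 hC)

theorem IsLeftSerialRing.of_laurentSeries (h : IsLeftSerialRing (LaurentSeries A)) :
    IsLeftSerialRing A ∧ IsArtinianRing A := by
  obtain ⟨ι, _, U, -, htop, hU⟩ := h
  have : IsArtinianRing A :=
    isArtinianRing_of_hasBoundedGenerators (hasBoundedGenerators_of_uniserial U hU htop)
  refine ⟨?_, this⟩
  obtain ⟨s, hs, hsup, hs'⟩ :=
    Ideal.HasRightIdentity.exists_supIndep (⊤ : Ideal A) ⟨1, trivial, fun n _ => mul_one n⟩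
  refine ⟨Fin s.card, inferInstance, fun i => (s.equivFin.symm i : Ideal A),
    hs.independent.comp s.equivFin.symm.injective, ?_, fun i => ?_⟩
  · rw [← hsup, s.equivFin.symm.iSup_comp (g := fun B : s => (B : Ideal A)),
      Finset.sup_eq_iSup, iSup_subtype]
    rfl
  · obtain ⟨h1, h2⟩ := hs' _ (s.equivFin.symm i).2
    exact isUniserialModule_of_supIrred htop hU h1 h2

end LaurentSeries

theorem exists_uniserial_decomposition_of_orderIso {R M S M' : Type*} [Ring R] [AddCommGroup M]
    [Module R M] [Ring S] [AddCommGroup M'] [Module S M'] (Φ : Submodule R M ≃o Submodule S M')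
    (h : ∃ (ι : Type) (_ : Fintype ι) (N : ι → Submodule R M),
      iSupIndep N ∧ (⨆ i, N i) = ⊤ ∧ ∀ i, IsUniserialModule R (N i)) :
    ∃ (ι : Type) (_ : Fintype ι) (N : ι → Submodule S M'),
      iSupIndep N ∧ (⨆ i, N i) = ⊤ ∧ ∀ i, IsUniserialModule S (N i) := by
  obtain ⟨ι, _, N, hind, htop, hN⟩ := h
  refine ⟨ι, inferInstance, Φ ∘ N, hind.map_orderIso Φ, ?_, fun i => ?_⟩
  · simp only [Function.comp_apply]
    rw [← Φ.map_iSup, htop, Φ.map_top]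
  · rw [isUniserialModule_submodule_iff]
    intro B hB C hC
    rw [← Φ.symm.le_iff_le, ← Φ.symm.le_iff_le (x := C)]
    exact isUniserialModule_submodule_iff.1 (hN i) _ (Φ.symm_apply_le.2 hB) _
      (Φ.symm_apply_le.2 hC)

section Opposite

open MulOpposite

/-- A ring as a right module over itself is its opposite ring as a left module over itself. -/
def rightModuleEquivOpposite (A : Type*) [Ring A] : A ≃ₗ[Aᵐᵒᵖ] Aᵐᵒᵖ where
  toFun := op
  invFun := unop
  map_add' _ _ := rfl
  map_smul' _ _ := rfl
  left_inv _ := rfl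
  right_inv _ := rfl

theorem isRightSerialRing_iff {A : Type*} [Ring A] :
    IsRightSerialRing A ↔ IsLeftSerialRing Aᵐᵒᵖ :=
  ⟨exists_uniserial_decomposition_of_orderIso
      (Submodule.orderIsoMapComap (rightModuleEquivOpposite A)),
    exists_uniserial_decomposition_of_orderIso
      (Submodule.orderIsoMapComap (rightModuleEquivOpposite A)).symm⟩

theorem isArtinian_mulOpposite_iff {A : Type*} [Ring A] :
    IsArtinian Aᵐᵒᵖ A ↔ IsArtinianRing Aᵐᵒᵖ :=
  (rightModuleEquivOpposite A).isArtinian_iff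

theorem IsLeftSerialRing.of_ringEquiv {R S : Type*} [Ring R] [Ring S] (e : R ≃+* S)
    (h : IsLeftSerialRing R) : IsLeftSerialRing S :=
  exists_uniserial_decomposition_of_orderIso (RingEquiv.idealComapOrderIso e).symm h

/-- The opposite of a ring of Laurent series is the ring of Laurent series over the opposite
ring. -/
def LaurentSeries.opRingEquiv (A : Type*) [Ring A] :
    (LaurentSeries A)ᵐᵒᵖ ≃+* LaurentSeries Aᵐᵒᵖ where
  toFun f := HahnSeries.mk (fun j => op (f.unop.coeff j))
    (f.unop.isPWO_support.mono fun _ hj h => hj (congrArg op h))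
  invFun f := op (HahnSeries.mk (fun j => (f.coeff j).unop)
    (f.isPWO_support.mono fun _ hj h => hj (congrArg unop h)))
  left_inv _ := rfl
  right_inv _ := rfl
  map_add' _ _ := rfl
  map_mul' f g := by
    refine HahnSeries.ext (funext fun j => ?_)
    change op ((g.unop * f.unop).coeff j) = _
    rw [HahnSeries.coeff_mul, HahnSeries.coeff_mul, Finset.op_sum]
    refine Finset.sum_nbij' Prod.swap Prod.swap ?_ ?_ (fun _ _ => rfl) (fun _ _ => rfl)
      (fun _ _ => rfl)
    · intro x hx
      simp only [Finset.mem_antidiagonal, HahnSeries.mem_support] at hx ⊢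
      exact ⟨fun h => hx.2.1 (congrArg unop h), fun h => hx.1 (congrArg unop h),
        (add_comm _ _).trans hx.2.2⟩
    · intro x hx
      simp only [Finset.mem_antidiagonal, HahnSeries.mem_support] at hx ⊢
      exact ⟨fun h => hx.2.1 (congrArg op h), fun h => hx.1 (congrArg op h),
        (add_comm _ _).trans hx.2.2⟩

end Opposite

/-- The following conditions are equivalent: (1) the Laurent series ring
`A((x))` is a right serial ring; (2) `A((x))` is a right serial right Artinian
ring; (3) `A` is a right serial right Artinian ring. -/
theorem laurentSeries_rightSerial_tfae (A : Type*) [Ring A] :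
    List.TFAE
      [IsRightSerialRing (LaurentSeries A),
       IsRightSerialRing (LaurentSeries A) ∧
         IsArtinian (LaurentSeries A)ᵐᵒᵖ (LaurentSeries A),
       IsRightSerialRing A ∧ IsArtinian Aᵐᵒᵖ A] := by
  rw [isRightSerialRing_iff, isRightSerialRing_iff, isArtinian_mulOpposite_iff,
    isArtinian_mulOpposite_iff]
  let e := LaurentSeries.opRingEquiv A
  tfae_have 2 → 1 := And.left
  tfae_have 1 → 3 := fun h => (h.of_ringEquiv e).of_laurentSeries
  tfae_have 3 → 2 := fun ⟨h, _⟩ =>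
    ⟨h.laurentSeries.1.of_ringEquiv e.symm, have := h.laurentSeries.2; e.symm.isArtinianRing⟩
  tfae_finish
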